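/- Let ω be a weight sequence, let ν be a finite positive Borel measure on the unit circle T singular with respect to Lebesgue measure, let U be the singular inner function associated with ν, and let λ > 0. Then U is cyclic in A²_ω if and only if U^λ (the singular inner function associated with the measure λν) is cyclic in A²_ω. -/

import Mathlib

open MeasureTheory Filter

/-- The singular inner function associated with a (finite positive) measure
`ν` on the unit circle, parametrized by the angle `t ∈ [0, 2π)`:
`U(z) = exp(-∫ (e^{it}+z)/(e^{it}-z) dν(t))`. -/
noncomputable def singInner (ν : Measure ℝ) (z : ℂ) : ℂ :=
  Complex.exp
    (-∫ t : ℝ, (Complex.exp (t * Complex.I) + z) / (Complex.exp (t * Complex.I) - z) ∂ν)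

/-- Taylor coefficient at 0. -/
noncomputable def taylorCoeff (f : ℂ → ℂ) (n : ℕ) : ℂ :=
  iteratedDeriv n f 0 / n.factorial

/-- Squared norm in the weighted Bergman space `A²_ω`. -/
noncomputable def wNormSq (ω : ℕ → ℝ) (f : ℂ → ℂ) : ℝ :=
  ∑' n : ℕ, ‖taylorCoeff f n‖ ^ 2 / ω n ^ 2

/-- Membership in the weighted Bergman space `A²_ω`. -/
def MemA (ω : ℕ → ℝ) (f : ℂ → ℂ) : Prop :=
  AnalyticOnNhd ℂ f (Metric.ball (0 : ℂ) 1) ∧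
    Summable (fun n : ℕ => ‖taylorCoeff f n‖ ^ 2 / ω n ^ 2)

/-- `f` is cyclic in `A²_ω`: polynomial multiples of `f` are dense. -/
def CyclicA (ω : ℕ → ℝ) (f : ℂ → ℂ) : Prop :=
  MemA ω f ∧ ∀ g : ℂ → ℂ, MemA ω g → ∀ ε : ℝ, 0 < ε →
    ∃ p : Polynomial ℂ, MemA ω (fun z => p.eval z * f z - g z) ∧
      wNormSq ω (fun z => p.eval z * f z - g z) < ε ^ 2


open Metric in
lemma tc_contDiff {f : ℂ → ℂ} (hf : AnalyticOnNhd ℂ f (ball 0 1)) (n : ℕ) :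
    ContDiffAt ℂ n f 0 :=
  (hf 0 (mem_ball_self one_pos)).contDiffAt

open Metric in
lemma tc_sub {f g : ℂ → ℂ} (hf : AnalyticOnNhd ℂ f (ball 0 1))
    (hg : AnalyticOnNhd ℂ g (ball 0 1)) (n : ℕ) :
    taylorCoeff (fun z => f z - g z) n = taylorCoeff f n - taylorCoeff g n := by
  unfold taylorCoeff
  rw [iteratedDeriv_fun_sub (tc_contDiff hf n) (tc_contDiff hg n), sub_div]

open Metric in
lemma tc_add {f g : ℂ → ℂ} (hf : AnalyticOnNhd ℂ f (ball 0 1))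
    (hg : AnalyticOnNhd ℂ g (ball 0 1)) (n : ℕ) :
    taylorCoeff (fun z => f z + g z) n = taylorCoeff f n + taylorCoeff g n := by
  unfold taylorCoeff
  rw [iteratedDeriv_fun_add (tc_contDiff hf n) (tc_contDiff hg n), add_div]

open Metric in
lemma tc_mul {f g : ℂ → ℂ} (hf : AnalyticOnNhd ℂ f (ball 0 1))
    (hg : AnalyticOnNhd ℂ g (ball 0 1)) (n : ℕ) :
    taylorCoeff (fun z => f z * g z) n =
      ∑ i ∈ Finset.range (n + 1), taylorCoeff f i * taylorCoeff g (n - i) := by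
  unfold taylorCoeff
  rw [iteratedDeriv_fun_mul (tc_contDiff hf n) (tc_contDiff hg n), Finset.sum_div]
  refine Finset.sum_congr rfl fun i hi => ?_
  have hi' : i ≤ n := by simpa [Nat.lt_succ_iff] using hi
  have h := Nat.choose_mul_factorial_mul_factorial hi'
  have h' : (n.factorial : ℂ) = n.choose i * i.factorial * (n - i).factorial := by
    rw [← h]; push_cast; ring
  have h1 : (i.factorial : ℂ) ≠ 0 := by exact_mod_cast i.factorial_ne_zero
  have h2 : ((n - i).factorial : ℂ) ≠ 0 := by exact_mod_cast (n - i).factorial_ne_zero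
  have h3 : (n.choose i : ℂ) ≠ 0 := by exact_mod_cast (Nat.choose_pos hi').ne'
  rw [h']
  field_simp

lemma poly_an (p : Polynomial ℂ) (s : Set ℂ) : AnalyticOnNhd ℂ (fun z => p.eval z) s :=
  (p.differentiable.differentiableOn.analyticOnNhd isOpen_univ).mono (Set.subset_univ _)

lemma tc_poly (p : Polynomial ℂ) (n : ℕ) : taylorCoeff (fun z => p.eval z) n = p.coeff n := by
  induction p using Polynomial.induction_on' with
  | add p q hp hq =>
    simp only [Polynomial.eval_add, Polynomial.coeff_add]
    rw [tc_add (poly_an p _) (poly_an q _), hp, hq]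
  | monomial m a =>
    unfold taylorCoeff
    simp only [Polynomial.eval_monomial]
    rw [iteratedDeriv_const_mul_field]
    rw [iteratedDeriv_pow, Polynomial.coeff_monomial]
    have h1 : (n.factorial : ℂ) ≠ 0 := by exact_mod_cast n.factorial_ne_zero
    rcases lt_trichotomy m n with h | h | h
    · simp [Nat.descFactorial_of_lt h, h.ne]
    · subst h; simp [Nat.descFactorial_self, h1]
    · have : m - n ≠ 0 := by omega
      simp [this, h.ne']

open Metric in
lemma tc_cauchy {f : ℂ → ℂ} (hf : AnalyticOnNhd ℂ f (ball 0 1)) {r : ℝ} (hr0 : 0 < r)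
    (hr1 : r < 1) (n : ℕ) :
    taylorCoeff f n * (r : ℂ) ^ n =
      fourierCoeffOn Real.two_pi_pos (fun θ => f (circleMap 0 r θ)) n := by
  obtain ⟨R, rfl⟩ : ∃ R : NNReal, (R : ℝ) = r := ⟨r.toNNReal, Real.coe_toNNReal r hr0.le⟩
  have hd : DifferentiableOn ℂ f (closedBall 0 R) :=
    hf.differentiableOn.mono (closedBall_subset_ball hr1)
  have hp := hd.hasFPowerSeriesOnBall (by exact_mod_cast hr0)
  have h := hp.factorial_smul ((R : ℝ) : ℂ) n
  rw [iteratedFDeriv_apply_eq_iteratedDeriv_mul_prod, cauchyPowerSeries_apply] at h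
  have h1 : (n.factorial : ℂ) ≠ 0 := by exact_mod_cast n.factorial_ne_zero
  unfold taylorCoeff
  simp only [Finset.prod_const, Finset.card_univ, Fintype.card_fin, nsmul_eq_mul, smul_eq_mul] at h
  have h2 : iteratedDeriv n f 0 / n.factorial * ((R : ℝ) : ℂ) ^ n =
    (2 * Real.pi * Complex.I)⁻¹ *
      ∮ z in C(0, R), (((R : ℝ) : ℂ) / (z - 0)) ^ n * ((z - 0)⁻¹ * f z) := by
    rw [div_mul_eq_mul_div, div_eq_iff h1, mul_comm (iteratedDeriv n f 0), ← h]
    ring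
  rw [h2, fourierCoeffOn_eq_integral, circleIntegral, ← intervalIntegral.integral_const_mul,
    ← intervalIntegral.integral_smul]
  refine intervalIntegral.integral_congr fun θ _ => ?_
  have hR : ((R : ℝ) : ℂ) ≠ 0 := by exact_mod_cast hr0.ne'
  have hpi : (Real.pi : ℂ) ≠ 0 := by exact_mod_cast Real.pi_ne_zero
  have he := Complex.exp_ne_zero (θ * Complex.I)
  have hf4 : (fourier (-(n : ℤ)) (θ : AddCircle (2 * Real.pi - 0)) : ℂ)
      = (Complex.exp (θ * Complex.I))⁻¹ ^ n := by
    rw [fourier_coe_apply, ← Complex.exp_neg, ← Complex.exp_nat_mul]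
    congr 1
    push_cast
    field_simp
    ring
  simp only [hf4, deriv_circleMap, sub_zero, circleMap, zero_add, smul_eq_mul, Complex.real_smul]
  push_cast
  field_simp

open Metric in
lemma contr_r {h f : ℂ → ℂ} (hh : AnalyticOnNhd ℂ h (ball 0 1))
    (hb : ∀ z ∈ ball (0 : ℂ) 1, ‖h z‖ ≤ 1)
    (hf : AnalyticOnNhd ℂ f (ball 0 1)) (k : ℕ) {r : ℝ} (hr0 : 0 < r) (hr1 : r < 1) :
    ∑ n ∈ Finset.range k, ‖taylorCoeff (fun z => h z * f z) n * (r : ℂ) ^ n‖ ^ 2 ≤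
      ∑ n ∈ Finset.range k, ‖taylorCoeff f n * (r : ℂ) ^ n‖ ^ 2 := by
  set P : Polynomial ℂ := ∑ n ∈ Finset.range k, Polynomial.monomial n (taylorCoeff f n) with hP
  set Q : Polynomial ℂ :=
    ∑ n ∈ Finset.range k, Polynomial.monomial n (taylorCoeff f n * (r : ℂ) ^ n) with hQ
  have hPc : ∀ n, n < k → P.coeff n = taylorCoeff f n := by
    intro n hn
    simp [hP, Polynomial.coeff_monomial, hn]
  have hQc : ∀ n, Q.coeff n = if n < k then taylorCoeff f n * (r : ℂ) ^ n else 0 := by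
    intro n
    simp [hQ, Polynomial.coeff_monomial]
  have hPQ : ∀ z, Q.eval z = P.eval (r * z) := by
    intro z
    simp only [hP, hQ, Polynomial.eval_finsetSum, Polynomial.eval_monomial]
    refine Finset.sum_congr rfl fun n _ => ?_
    rw [mul_pow]; ring
  have hPa := poly_an P (ball (0 : ℂ) 1)
  have hF : AnalyticOnNhd ℂ (fun z => h z * P.eval z) (ball 0 1) := hh.mul hPa
  have e1 : ∀ n ∈ Finset.range k, taylorCoeff (fun z => h z * f z) n =
      taylorCoeff (fun z => h z * P.eval z) n := by
    intro n hn
    rw [tc_mul hh hf, tc_mul hh hPa]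
    refine Finset.sum_congr rfl fun i hi => ?_
    rw [tc_poly, hPc]
    have := Finset.mem_range.1 hn
    omega
  have hmem : ∀ θ, circleMap 0 r θ ∈ ball (0 : ℂ) 1 := by
    intro θ
    simp [abs_of_pos hr0, hr1]
  have hcont : Continuous fun θ => h (circleMap 0 r θ) * P.eval (circleMap 0 r θ) :=
    hF.continuousOn.comp_continuous (continuous_circleMap 0 r) hmem
  have hL2 : MemLp (fun θ => h (circleMap 0 r θ) * P.eval (circleMap 0 r θ)) 2
      (volume.restrict (Set.Ioc 0 (2 * Real.pi))) := by
    have : IsCompact (Set.Icc (0 : ℝ) (2 * Real.pi)) := isCompact_Icc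
    refine MemLp.mono_measure (Measure.restrict_mono Set.Ioc_subset_Icc_self le_rfl) ?_
    obtain ⟨C, hC⟩ := this.exists_bound_of_continuousOn hcont.continuousOn
    exact MemLp.of_bound hcont.aestronglyMeasurable C
      (ae_restrict_of_forall_mem measurableSet_Icc hC)
  have hs := hasSum_sq_fourierCoeffOn Real.two_pi_pos hL2
  have e2 : ∑ n ∈ Finset.range k, ‖taylorCoeff (fun z => h z * f z) n * (r : ℂ) ^ n‖ ^ 2 =
      ∑ i ∈ (Finset.range k).map Nat.castEmbedding, ‖fourierCoeffOn Real.two_pi_pos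
        (fun θ => h (circleMap 0 r θ) * P.eval (circleMap 0 r θ)) i‖ ^ 2 := by
    rw [Finset.sum_map]
    refine Finset.sum_congr rfl fun n hn => ?_
    rw [e1 n hn, tc_cauchy hF hr0 hr1]
    rfl
  have e3 : ∑ n ∈ Finset.range k, ‖taylorCoeff f n * (r : ℂ) ^ n‖ ^ 2 =
      ∑ i ∈ Q.support, ‖Q.coeff i‖ ^ 2 := by
    symm
    rw [Finset.sum_subset (s₂ := Finset.range k)]
    · refine Finset.sum_congr rfl fun n hn => ?_
      rw [hQc, if_pos (Finset.mem_range.1 hn)]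
    · intro n hn
      by_contra hc
      rw [Polynomial.mem_support_iff, hQc, if_neg (by simpa using hc)] at hn
      exact hn rfl
    · intro n _ hn
      simp [Polynomial.notMem_support_iff.1 hn]
  rw [e2, e3, Polynomial.sum_sq_norm_coeff_eq_circleAverage]
  refine (sum_le_hasSum _ (fun _ _ => by positivity) hs).trans ?_
  rw [Real.circleAverage_def, sub_zero]
  refine smul_le_smul_of_nonneg_left ?_ (by positivity)
  have hc' : Continuous fun θ => Q.eval (circleMap 0 1 θ) :=
    Q.continuous.comp (continuous_circleMap 0 1)
  refine intervalIntegral.integral_mono_on Real.two_pi_pos.le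
    (by apply Continuous.intervalIntegrable; fun_prop)
    (by apply Continuous.intervalIntegrable; fun_prop) fun θ _ => ?_
  have : (r : ℂ) * circleMap 0 1 θ = circleMap 0 r θ := by simp [circleMap]
  rw [hPQ, this, norm_mul]
  have := hb _ (hmem θ)
  gcongr
  exact mul_le_of_le_one_left (norm_nonneg _) this

open Metric in
lemma contr {h f : ℂ → ℂ} (hh : AnalyticOnNhd ℂ h (ball 0 1))
    (hb : ∀ z ∈ ball (0 : ℂ) 1, ‖h z‖ ≤ 1)
    (hf : AnalyticOnNhd ℂ f (ball 0 1)) (k : ℕ) :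
    ∑ n ∈ Finset.range k, ‖taylorCoeff (fun z => h z * f z) n‖ ^ 2 ≤
      ∑ n ∈ Finset.range k, ‖taylorCoeff f n‖ ^ 2 := by
  have key : ∀ a : ℕ → ℂ, Tendsto (fun r : ℝ => ∑ n ∈ Finset.range k, ‖a n * (r : ℂ) ^ n‖ ^ 2)
      (nhdsWithin 1 (Set.Ioo 0 1)) (nhds (∑ n ∈ Finset.range k, ‖a n‖ ^ 2)) := by
    intro a
    have : Continuous (fun r : ℝ => ∑ n ∈ Finset.range k, ‖a n * (r : ℂ) ^ n‖ ^ 2) := by fun_prop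
    have h1 := (this.tendsto 1).mono_left (nhdsWithin_le_nhds (s := Set.Ioo 0 1))
    simpa using h1
  have : (nhdsWithin (1 : ℝ) (Set.Ioo 0 1)).NeBot := right_nhdsWithin_Ioo_neBot one_pos
  refine le_of_tendsto_of_tendsto (key _) (key _) ?_
  filter_upwards [self_mem_nhdsWithin] with r hr
  exact contr_r hh hb hf k hr.1 hr.2

lemma abel_ineq (w d : ℕ → ℝ) (hw : Antitone w) (hd : ∀ k, 0 ≤ ∑ n ∈ Finset.range k, d n)
    (N : ℕ) : w N * ∑ n ∈ Finset.range (N + 1), d n ≤ ∑ n ∈ Finset.range (N + 1), w n * d n := by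
  induction N with
  | zero => simp
  | succ N ih =>
    rw [Finset.sum_range_succ, Finset.sum_range_succ (fun n => w n * d n)]
    have := mul_le_mul_of_nonneg_right (hw (Nat.le_succ N)) (hd (N + 1))
    simp only [Nat.succ_eq_add_one] at this
    linarith

open Metric in
lemma mult_A {ω : ℕ → ℝ} (hωpos : ∀ n, 0 < ω n) (hωmono : Monotone ω) {h f : ℂ → ℂ}
    (hh : AnalyticOnNhd ℂ h (ball 0 1)) (hb : ∀ z ∈ ball (0 : ℂ) 1, ‖h z‖ ≤ 1)
    (hf : MemA ω f) :
    MemA ω (fun z => h z * f z) ∧ wNormSq ω (fun z => h z * f z) ≤ wNormSq ω f := by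
  obtain ⟨hfa, hfs⟩ := hf
  have hw : Antitone fun n => 1 / ω n ^ 2 := by
    intro m n hmn
    have := hωpos m
    have := hωmono hmn
    simp only
    gcongr
  have hpart : ∀ N, ∑ n ∈ Finset.range N, ‖taylorCoeff (fun z => h z * f z) n‖ ^ 2 / ω n ^ 2 ≤
      ∑' n, ‖taylorCoeff f n‖ ^ 2 / ω n ^ 2 := by
    intro N
    refine le_trans ?_ (hfs.sum_le_tsum (Finset.range N) (fun _ _ => by positivity))
    cases N with
    | zero => simp
    | succ N =>
      have hd : ∀ k, 0 ≤ ∑ n ∈ Finset.range k,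
          (‖taylorCoeff f n‖ ^ 2 - ‖taylorCoeff (fun z => h z * f z) n‖ ^ 2) := by
        intro k
        rw [Finset.sum_sub_distrib, sub_nonneg]
        exact contr hh hb hfa k
      have h1 := abel_ineq _ _ hw hd N
      have h2 := mul_nonneg (show 0 ≤ 1 / ω N ^ 2 by positivity) (hd (N + 1))
      have h3 := h2.trans h1
      simp only [mul_sub, Finset.sum_sub_distrib, sub_nonneg] at h3
      simpa [div_eq_inv_mul] using h3
  have hsum := summable_of_sum_range_le (fun n => by positivity) hpart
  exact ⟨⟨hh.mul hfa, hsum⟩, Real.tsum_le_of_sum_range_le (fun n => by positivity) hpart⟩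

lemma sub_A {ω : ℕ → ℝ} {f g : ℂ → ℂ} (hf : MemA ω f) (hg : MemA ω g) :
    MemA ω (fun z => f z - g z) ∧
      wNormSq ω (fun z => f z - g z) ≤ 2 * wNormSq ω f + 2 * wNormSq ω g := by
  have hle : ∀ n, ‖taylorCoeff (fun z => f z - g z) n‖ ^ 2 / ω n ^ 2 ≤
      2 * (‖taylorCoeff f n‖ ^ 2 / ω n ^ 2) + 2 * (‖taylorCoeff g n‖ ^ 2 / ω n ^ 2) := by
    intro n
    rw [tc_sub hf.1 hg.1, ← mul_div_assoc, ← mul_div_assoc, ← add_div]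
    gcongr
    have h1 := norm_sub_le (taylorCoeff f n) (taylorCoeff g n)
    have h2 := norm_nonneg (taylorCoeff f n - taylorCoeff g n)
    nlinarith [sq_nonneg (‖taylorCoeff f n‖ - ‖taylorCoeff g n‖)]
  have hs := (hf.2.mul_left 2).add (hg.2.mul_left 2)
  have hs' := Summable.of_nonneg_of_le (fun n => by positivity) hle hs
  refine ⟨⟨hf.1.sub hg.1, hs'⟩, ?_⟩
  unfold wNormSq
  rw [← tsum_mul_left, ← tsum_mul_left, ← (hf.2.mul_left 2).tsum_add (hg.2.mul_left 2)]
  exact hs'.tsum_le_tsum hle hs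

lemma poly_A (ω : ℕ → ℝ) (p : Polynomial ℂ) : MemA ω (fun z => p.eval z) := by
  refine ⟨poly_an p _, summable_of_hasFiniteSupport (p.support.finite_toSet.subset ?_)⟩
  intro n hn
  simp only [Function.mem_support, tc_poly] at hn
  simp only [Finset.mem_coe, Polynomial.mem_support_iff]
  rintro h0
  simp [h0] at hn

lemma dense_poly {ω : ℕ → ℝ} {V : ℂ → ℂ} (hV : MemA ω V) {ε : ℝ} (hε : 0 < ε) :
    ∃ q : Polynomial ℂ, wNormSq ω (fun z => q.eval z - V z) < ε := by
  have ht := tendsto_sum_nat_add (fun n => ‖taylorCoeff V n‖ ^ 2 / ω n ^ 2)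
  obtain ⟨N, hN⟩ := (ht.eventually (gt_mem_nhds hε)).exists
  set q : Polynomial ℂ := ∑ n ∈ Finset.range N, Polynomial.monomial n (taylorCoeff V n) with hq
  have hqc : ∀ n, q.coeff n = if n < N then taylorCoeff V n else 0 := by
    intro n
    simp [hq, Polynomial.coeff_monomial]
  refine ⟨q, lt_of_eq_of_lt ?_ hN⟩
  have hmem := (sub_A (poly_A ω q) hV).1
  unfold wNormSq
  rw [← hmem.2.sum_add_tsum_nat_add N, Finset.sum_eq_zero, zero_add]
  · congr 1; ext n
    rw [tc_sub (poly_an q _) hV.1, tc_poly, hqc]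
    simp
  · intro n hn
    rw [tc_sub (poly_an q _) hV.1, tc_poly, hqc]
    simp [Finset.mem_range.1 hn]

/-- The Herglotz integral of the measure. -/
noncomputable def herg (ν : Measure ℝ) (z : ℂ) : ℂ :=
  ∫ t : ℝ, (Complex.exp (t * Complex.I) + z) / (Complex.exp (t * Complex.I) - z) ∂ν

lemma exp_sub_ge (t : ℝ) (z : ℂ) : 1 - ‖z‖ ≤ ‖Complex.exp (t * Complex.I) - z‖ := by
  have := norm_sub_norm_le (Complex.exp (t * Complex.I)) z
  rwa [Complex.norm_exp_ofReal_mul_I] at this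

lemma exp_sub_ne (t : ℝ) {z : ℂ} (hz : ‖z‖ < 1) : Complex.exp (t * Complex.I) - z ≠ 0 := by
  have := exp_sub_ge t z
  rw [← norm_pos_iff]
  linarith

open Metric in
lemma herg_an (ν : Measure ℝ) [IsFiniteMeasure ν] :
    AnalyticOnNhd ℂ (herg ν) (ball 0 1) := by
  refine DifferentiableOn.analyticOnNhd ?_ isOpen_ball
  intro z₀ hz₀
  refine DifferentiableAt.differentiableWithinAt ?_
  have hz₀' : ‖z₀‖ < 1 := by simpa using hz₀
  obtain ⟨ρ, hρ0, hρ1⟩ := exists_between hz₀'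
  have hs : ball (0 : ℂ) ρ ∈ nhds z₀ := isOpen_ball.mem_nhds (by simpa using hρ0)
  have hcont : ∀ z : ℂ, ‖z‖ < 1 → Continuous fun t : ℝ =>
      (Complex.exp (t * Complex.I) + z) / (Complex.exp (t * Complex.I) - z) := by
    intro z hz
    exact Continuous.div (by fun_prop) (by fun_prop) fun t => exp_sub_ne t hz
  have hcont' : Continuous fun t : ℝ =>
      2 * Complex.exp (t * Complex.I) / (Complex.exp (t * Complex.I) - z₀) ^ 2 := by
    exact Continuous.div (by fun_prop) (by fun_prop) fun t => pow_ne_zero 2 (exp_sub_ne t hz₀')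
  refine (hasDerivAt_integral_of_dominated_loc_of_deriv_le
    (F' := fun z (t : ℝ) => 2 * Complex.exp (t * Complex.I) / (Complex.exp (t * Complex.I) - z) ^ 2)
    (bound := fun _ => 2 / (1 - ρ) ^ 2) hs ?_ ?_ hcont'.aestronglyMeasurable ?_
    (integrable_const _) ?_).2.differentiableAt
  · filter_upwards [hs] with z hz
    exact (hcont z (by have : ‖z‖ < ρ := by simpa using hz
                       linarith)).aestronglyMeasurable
  · refine Integrable.of_bound (hcont z₀ hz₀').aestronglyMeasurable (2 / (1 - ‖z₀‖))
      (ae_of_all _ fun t => ?_)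
    rw [norm_div]
    have h1 := exp_sub_ge t z₀
    have h2 : ‖Complex.exp (t * Complex.I) + z₀‖ ≤ 2 := by
      refine (norm_add_le _ _).trans ?_
      rw [Complex.norm_exp_ofReal_mul_I]; linarith
    have : 0 < 1 - ‖z₀‖ := by linarith
    gcongr
  · refine ae_of_all _ fun t z hz => ?_
    have hz' : ‖z‖ < ρ := by simpa using hz
    have h1 := exp_sub_ge t z
    have : 0 < 1 - ρ := by linarith
    rw [norm_div, norm_mul, norm_pow, Complex.norm_exp_ofReal_mul_I]
    have h3 : 1 - ρ ≤ ‖Complex.exp (t * Complex.I) - z‖ := by linarith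
    simp only [Complex.norm_ofNat, mul_one]
    gcongr
  · refine ae_of_all _ fun t z hz => ?_
    have hz' : ‖z‖ < ρ := by simpa using hz
    have hne := exp_sub_ne t (hz'.trans hρ1)
    have h := ((hasDerivAt_id z).const_add (Complex.exp (t * Complex.I))).div
      ((hasDerivAt_id z).const_sub (Complex.exp (t * Complex.I))) hne
    refine HasDerivAt.congr_deriv h ?_
    simp only [id]
    ring

lemma re_div_nonneg (t : ℝ) {z : ℂ} (hz : ‖z‖ < 1) :
    0 ≤ ((Complex.exp (t * Complex.I) + z) / (Complex.exp (t * Complex.I) - z)).re := by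
  set e := Complex.exp (t * Complex.I) with he
  have h1 : Complex.normSq e = 1 := by
    rw [Complex.normSq_eq_norm_sq, he, Complex.norm_exp_ofReal_mul_I]; norm_num
  have h2 : Complex.normSq z ≤ 1 := by
    rw [Complex.normSq_eq_norm_sq]; nlinarith [norm_nonneg z]
  rw [Complex.div_re, ← add_div]
  refine div_nonneg ?_ (Complex.normSq_nonneg _)
  rw [Complex.normSq_apply] at h1 h2
  simp only [Complex.add_re, Complex.sub_re, Complex.add_im, Complex.sub_im]
  nlinarith

lemma herg_re (ν : Measure ℝ) {z : ℂ} (hz : ‖z‖ < 1) : 0 ≤ (herg ν z).re := by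
  unfold herg
  by_cases hi : Integrable (fun t : ℝ =>
      (Complex.exp (t * Complex.I) + z) / (Complex.exp (t * Complex.I) - z)) ν
  · have h := integral_re hi
    refine le_of_le_of_eq ?_ h
    exact integral_nonneg fun t => re_div_nonneg t hz
  · rw [integral_undef hi]; simp

/-- Real powers of the singular inner function. -/
noncomputable def upow (ν : Measure ℝ) (s : ℝ) (z : ℂ) : ℂ := Complex.exp (-(s * herg ν z))

lemma singInner_smul (ν : Measure ℝ) {s : ℝ} (hs : 0 ≤ s) :
    singInner (ENNReal.ofReal s • ν) = upow ν s := by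
  ext z
  unfold singInner upow herg
  rw [integral_smul_measure, ENNReal.toReal_ofReal hs, Complex.real_smul]

lemma singInner_one (ν : Measure ℝ) : singInner ν = upow ν 1 := by
  rw [← singInner_smul ν zero_le_one]; simp

open Metric in
lemma upow_an (ν : Measure ℝ) [IsFiniteMeasure ν] (s : ℝ) :
    AnalyticOnNhd ℂ (upow ν s) (ball 0 1) := by
  have := (analyticOnNhd_const (v := (s : ℂ))).mul (herg_an ν)
  exact this.neg.cexp

open Metric in
lemma upow_le (ν : Measure ℝ) {s : ℝ} (hs : 0 ≤ s) :
    ∀ z ∈ ball (0 : ℂ) 1, ‖upow ν s z‖ ≤ 1 := by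
  intro z hz
  have := mul_nonneg hs (herg_re ν (z := z) (by simpa using hz))
  rw [upow, Complex.norm_exp]
  simpa using this

lemma upow_add (ν : Measure ℝ) (s t : ℝ) (z : ℂ) :
    upow ν (s + t) z = upow ν s z * upow ν t z := by
  unfold upow
  rw [← Complex.exp_add]; congr 1; push_cast; ring

open Metric in
lemma bdd_A {ω : ℕ → ℝ} (hωpos : ∀ n, 0 < ω n) (hωmono : Monotone ω)
    {h : ℂ → ℂ} (hh : AnalyticOnNhd ℂ h (ball 0 1))
    (hb : ∀ z ∈ ball (0 : ℂ) 1, ‖h z‖ ≤ 1) : MemA ω h := by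
  have := (mult_A hωpos hωmono hh hb (poly_A ω 1)).1
  simpa using this

open Metric in
lemma cyc_down {ω : ℕ → ℝ} (hωpos : ∀ n, 0 < ω n) (hωmono : Monotone ω) {U V : ℂ → ℂ}
    (hU : AnalyticOnNhd ℂ U (ball 0 1)) (hUb : ∀ z ∈ ball (0 : ℂ) 1, ‖U z‖ ≤ 1)
    (hV : AnalyticOnNhd ℂ V (ball 0 1)) (hVb : ∀ z ∈ ball (0 : ℂ) 1, ‖V z‖ ≤ 1)
    (hc : CyclicA ω (fun z => U z * V z)) : CyclicA ω U := by
  refine ⟨bdd_A hωpos hωmono hU hUb, fun g hg ε hε => ?_⟩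
  obtain ⟨p, hp1, hp2⟩ := hc.2 g hg (ε / 2) (by positivity)
  have hVp := (mult_A hωpos hωmono hV hVb (poly_A ω p)).1
  obtain ⟨q, hq⟩ := dense_poly hVp (show 0 < (ε / 2) ^ 2 by positivity)
  have hd := (sub_A (poly_A ω q) hVp).1
  have hm := mult_A hωpos hωmono hU.neg (by simpa using hUb) hd
  have hf := sub_A hp1 hm.1
  have heq : (fun z => (Polynomial.eval z p * (U z * V z) - g z) -
      (-U) z * (Polynomial.eval z q - V z * Polynomial.eval z p)) =
      fun z => Polynomial.eval z q * U z - g z := by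
    ext z; simp only [Pi.neg_apply]; ring
  rw [heq] at hf
  exact ⟨q, hf.1, by linarith [hf.2, hm.2]⟩

open Metric in
lemma cyc_up {ω : ℕ → ℝ} (hωpos : ∀ n, 0 < ω n) (hωmono : Monotone ω) {U V : ℂ → ℂ}
    (hU : AnalyticOnNhd ℂ U (ball 0 1)) (hUb : ∀ z ∈ ball (0 : ℂ) 1, ‖U z‖ ≤ 1)
    (hcU : CyclicA ω U) (hcV : CyclicA ω V) : CyclicA ω (fun z => U z * V z) := by
  refine ⟨(mult_A hωpos hωmono hU hUb hcV.1).1, fun g hg ε hε => ?_⟩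
  obtain ⟨p, hp1, hp2⟩ := hcU.2 g hg (ε / 2) (by positivity)
  obtain ⟨q, hq1, hq2⟩ := hcV.2 _ (poly_A ω p) (ε / 2) (by positivity)
  have hm := mult_A hωpos hωmono hU.neg (by simpa using hUb) hq1
  have hf := sub_A hp1 hm.1
  have heq : (fun z => (Polynomial.eval z p * U z - g z) -
      (-U) z * (Polynomial.eval z q * V z - Polynomial.eval z p)) =
      fun z => Polynomial.eval z q * (U z * V z) - g z := by
    ext z; simp only [Pi.neg_apply]; ring
  rw [heq] at hf
  exact ⟨q, hf.1, by linarith [hf.2, hm.2]⟩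

lemma cyc_nat {ω : ℕ → ℝ} (hωpos : ∀ n, 0 < ω n) (hωmono : Monotone ω)
    (ν : Measure ℝ) [IsFiniteMeasure ν] {a : ℝ} (ha : 0 < a) (hc : CyclicA ω (upow ν a))
    (n : ℕ) : CyclicA ω (upow ν ((n + 1 : ℕ) * a)) := by
  induction n with
  | zero => simpa using hc
  | succ n ih =>
    have := cyc_up hωpos hωmono (upow_an ν _) (upow_le ν (by positivity)) ih hc
    have heq : (fun z => upow ν ((n + 1 : ℕ) * a) z * upow ν a z) =
        upow ν ((n + 1 + 1 : ℕ) * a) := by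
      ext z
      rw [← upow_add]
      congr 1; push_cast; ring
    rwa [heq] at this

lemma cyc_real {ω : ℕ → ℝ} (hωpos : ∀ n, 0 < ω n) (hωmono : Monotone ω)
    (ν : Measure ℝ) [IsFiniteMeasure ν] {a b : ℝ} (ha : 0 < a) (hb : 0 < b)
    (hc : CyclicA ω (upow ν a)) : CyclicA ω (upow ν b) := by
  obtain ⟨n, hn⟩ := exists_nat_ge (b / a)
  rw [div_le_iff₀ ha] at hn
  have h1 := cyc_nat hωpos hωmono ν ha hc n
  have hle : 0 ≤ ((n + 1 : ℕ) : ℝ) * a - b := by push_cast; linarith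
  refine cyc_down hωpos hωmono (upow_an ν b) (upow_le ν hb.le)
    (upow_an ν (((n + 1 : ℕ) : ℝ) * a - b)) (upow_le ν hle) ?_
  have heq : (fun z => upow ν b z * upow ν (((n + 1 : ℕ) : ℝ) * a - b) z) =
      upow ν ((n + 1 : ℕ) * a) := by
    ext z
    rw [← upow_add]
    congr 1; ring
  rwa [heq]

/-- **Lemma 2.** For a singular inner function `U` and `λ > 0`, `U` is cyclic
in `A²_ω` if and only if `U^λ` (the singular inner function of `λν`) is. -/
theorem cyclic_iff_cyclic_pow
    (ω : ℕ → ℝ) (hωpos : ∀ n, 0 < ω n) (hωmono : Monotone ω)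
    (hωtop : Tendsto ω atTop atTop)
    (hωo : (fun n : ℕ => Real.log (ω n)) =o[atTop] (fun n : ℕ => (n : ℝ)))
    (ν : Measure ℝ) [IsFiniteMeasure ν]
    (hνsing : ν.MutuallySingular volume)
    (hνsupp : ν (Set.Ico 0 (2 * Real.pi))ᶜ = 0)
    (lam : ℝ) (hlam : 0 < lam) :
    CyclicA ω (singInner ν) ↔ CyclicA ω (singInner (ENNReal.ofReal lam • ν)) := by
  rw [singInner_smul ν hlam.le, singInner_one ν]
  exact ⟨cyc_real hωpos hωmono ν one_pos hlam, cyc_real hωpos hωmono ν hlam one_pos⟩
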